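/- arXiv:1611.08803 — 2 statements merged into one kernel-verified Lean document; each statement's English description precedes it below -/
import Mathlib

section
/- (Cherkasskii) A feasible multiflow f in an instance (G,T,c) is maximum (i.e., maximizes α among feasible multiflows) if and only if there exists a cut-system 𝒳 of T such that α(f) = ½·γ(𝒳). -/
open Classical

/-- The set of edges of `G` with exactly one endpoint in `X`. -/
def EdgeCut {V : Type*} (G : SimpleGraph V) (X : Set V) : Set (Sym2 V) :=
  {e | e ∈ G.edgeSet ∧ ∃ x y, e = s(x, y) ∧ x ∈ X ∧ y ∉ X}

/-- `h(X)`: the sum of `h` over the edges of the cut `E(X)`. -/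
noncomputable def cutVal {V : Type*} (G : SimpleGraph V) (X : Set V)
    (h : Sym2 V → NNReal) : NNReal :=
  ∑ᶠ e ∈ EdgeCut G X, h e

/-- A member of `𝒫(T)`: a path joining two distinct terminals of `T`. -/
def IsTPath {V : Type*} (G : SimpleGraph V) (T : Set V)
    (P : Σ u : V, Σ w : V, G.Walk u w) : Prop :=
  P.1 ∈ T ∧ P.2.1 ∈ T ∧ P.1 ≠ P.2.1 ∧ P.2.2.IsPath

/-- `g` is a path decomposition of `f` over paths between distinct terminals of `T`. -/
def IsDecomposition {V : Type*} (G : SimpleGraph V) (T : Set V) (f : Sym2 V → NNReal)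
    (g : (Σ u : V, Σ w : V, G.Walk u w) → NNReal) : Prop :=
  (∀ P, g P ≠ 0 → IsTPath G T P) ∧
  ∀ e ∈ G.edgeSet,
    f e = ∑ᶠ P ∈ {P : Σ u : V, Σ w : V, G.Walk u w | IsTPath G T P ∧ e ∈ P.2.2.edges}, g P

/-- `f` is a multiflow for terminals `T`. -/
def IsMultiflow {V : Type*} (G : SimpleGraph V) (T : Set V) (f : Sym2 V → NNReal) : Prop :=
  ∃ g, IsDecomposition G T f g

/-- `f` is feasible: bounded by the capacity on every edge. -/
def FeasibleFlow {V : Type*} (G : SimpleGraph V) (c f : Sym2 V → NNReal) : Prop :=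
  ∀ e ∈ G.edgeSet, f e ≤ c e

/-- `α(f) = ½ Σ_{t ∈ T} f(E({t}))`. -/
noncomputable def flowValue {V : Type*} (G : SimpleGraph V) (T : Set V)
    (f : Sym2 V → NNReal) : NNReal :=
  (∑ᶠ t ∈ T, cutVal G {t} f) / 2

/-- `𝒳` is a cut-system of `T`: pairwise disjoint terminal sets, one for each terminal. -/
def IsCutSystem {V : Type*} (G : SimpleGraph V) (T : Set V) (𝒳 : V → Set V) : Prop :=
  (∀ t ∈ T, (𝒳 t) ∩ T = {t} ∧ (G.induce (𝒳 t)).Connected) ∧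
  ∀ t ∈ T, ∀ t' ∈ T, t ≠ t' → 𝒳 t ∩ 𝒳 t' = ∅

/-- `γ(𝒳) = Σ_{X ∈ 𝒳} c(X)`. -/
noncomputable def gammaVal {V : Type*} (G : SimpleGraph V) (T : Set V)
    (c : Sym2 V → NNReal) (𝒳 : V → Set V) : NNReal :=
  ∑ᶠ t ∈ T, cutVal G (𝒳 t) c

open SimpleGraph Finset

section LinearProgramming

/-- Strong duality for the fractional packing of a finite family of finite sets. -/
lemma exists_fractional_cover {ι κ : Type*} [Fintype ι] [Fintype κ] (S : κ → Finset ι)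
    (c : ι → ℝ) (hc : ∀ i, 0 ≤ c i) (M : ℝ)
    (hM : ∀ g : κ → ℝ, (∀ k, 0 ≤ g k) → (∀ i, ∑ k, (if i ∈ S k then g k else 0) ≤ c i) →
      ∑ k, g k ≤ M) :
    ∃ l : ι → ℝ, (∀ i, 0 ≤ l i) ∧ (∀ k, 1 ≤ ∑ i ∈ S k, l i) ∧ ∑ i, c i * l i ≤ M := by
  have hM0 : 0 ≤ M := by simpa using hM 0 (by simp) (by simpa using hc)
  let D : Set ((ι → ℝ) × ℝ) := {p | (∀ i, 0 < c i → p.1 i < c i) ∧ M < p.2}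
  let K : Set ((ι → ℝ) × ℝ) := {p | ∃ g : κ → ℝ, (∀ k, 0 ≤ g k) ∧
    (∀ k, ∀ i ∈ S k, c i = 0 → g k = 0) ∧ (∀ i, p.1 i = ∑ k, (if i ∈ S k then g k else 0)) ∧
    p.2 = ∑ k, g k}
  have hDo : IsOpen D := by
    have : D = (⋂ i, {p | 0 < c i → p.1 i < c i}) ∩ {p | M < p.2} := by
      ext p; simp [D]
    rw [this]
    refine (isOpen_iInter_of_finite fun i => ?_).inter (isOpen_lt continuous_const continuous_snd)
    by_cases h : 0 < c i
    · simp only [h, forall_const]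
      exact isOpen_lt ((continuous_apply i).comp continuous_fst) continuous_const
    · simp [h]
  have hDc : Convex ℝ D := by
    rintro ⟨y, m⟩ ⟨h1, h2⟩ ⟨y', m'⟩ ⟨h1', h2'⟩ a b ha hb hab
    have key : ∀ x x' z : ℝ, x < z → x' < z → a * x + b * x' < z := fun x x' z hx hx' =>
      (convex_Iio (𝕜 := ℝ) z) hx hx' ha hb hab
    refine ⟨fun i hi => key _ _ _ (h1 i hi) (h1' i hi), ?_⟩
    have := key (-m) (-m') (-M) (by simpa using h2) (by simpa using h2')
    simp only [Prod.snd_add, Prod.smul_snd, smul_eq_mul]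
    linarith
  have hKc : Convex ℝ K := by
    rintro ⟨y, m⟩ ⟨g, h1, h2, h3, h4⟩ ⟨y', m'⟩ ⟨g', h1', h2', h3', h4'⟩ a b ha hb hab
    refine ⟨fun k => a * g k + b * g' k, fun k => ?_, fun k i hi hci => ?_, fun i => ?_, ?_⟩
    · have := h1 k; have := h1' k; positivity
    · simp [h2 k i hi hci, h2' k i hi hci]
    · simp only at h3 h3'
      simp only [Prod.smul_mk, Prod.mk_add_mk, Pi.add_apply, Pi.smul_apply, smul_eq_mul, h3, h3',
        mul_sum, ← sum_add_distrib]
      exact sum_congr rfl fun k _ => by split_ifs <;> simp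
    · simp only at h4 h4'
      simp [h4, h4', mul_sum, sum_add_distrib]
  have hdisj : Disjoint D K := by
    rw [Set.disjoint_left]
    rintro ⟨y, m⟩ ⟨h1, h2⟩ ⟨g, h3, h4, h5, h6⟩
    simp only at h1 h2 h5 h6
    refine absurd (hM g h3 fun i => ?_) (by rw [← h6]; exact not_le.2 h2)
    rcases (hc i).eq_or_lt with h | h
    · refine (sum_eq_zero fun k _ => ?_).trans_le (hc i)
      split_ifs with hi
      exacts [h4 k i hi h.symm, rfl]
    · rw [← h5]; exact (h1 i h).le
  obtain ⟨φ, u, hφD, hφK⟩ := geometric_hahn_banach_open hDc hDo hKc hdisj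
  let a : ι → ℝ := fun i => φ (Pi.single i 1, 0)
  let b : ℝ := φ (0, 1)
  have hφ : ∀ (y : ι → ℝ) (m : ℝ), φ (y, m) = ∑ i, y i * a i + m * b := by
    intro y m
    have : ((y, m) : (ι → ℝ) × ℝ) =
        ∑ i, y i • ((Pi.single i 1, 0) : (ι → ℝ) × ℝ) + m • (0, 1) := by
      ext j
      · simp [Prod.fst_sum, Finset.sum_apply, Pi.single_apply]
      · simp [Prod.snd_sum]
    rw [this, map_add, map_sum]
    simp only [map_smul, smul_eq_mul, a, b]
  have hu : u ≤ 0 := by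
    simpa using hφK 0 ⟨0, by simp, by simp, by simp, by simp⟩
  have hD : ∀ (y : ι → ℝ) (m : ℝ), (∀ i, 0 < c i → y i < c i) → M < m → ∑ i, y i * a i + m * b < 0 :=
    fun y m h1 h2 => by rw [← hφ]; exact (hφD (y, m) ⟨h1, h2⟩).trans_le hu
  have hb : b < 0 := by
    have := hD 0 (M + 1) (by simp) (by linarith)
    simp only [Pi.zero_apply, zero_mul, sum_const_zero, zero_add] at this
    by_contra h
    nlinarith
  have ha : ∀ i, 0 ≤ a i := by
    intro i
    by_contra! h
    have hs : 0 ≤ (M + 1) * b / a i :=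
      div_nonneg_of_nonpos (mul_nonpos_of_nonneg_of_nonpos (by linarith) hb.le) h.le
    have h1 := hD (Pi.single i (-((M + 1) * b / a i))) (M + 1) (fun j hj => ?_) (by linarith)
    · simp [Pi.single_apply, div_mul_cancel₀ _ h.ne] at h1
    · refine lt_of_le_of_lt ?_ hj
      rw [Pi.single_apply]
      split_ifs <;> linarith
  have hk : ∀ k, (∀ i ∈ S k, c i ≠ 0) → -b ≤ ∑ i ∈ S k, a i := by
    intro k hk
    by_contra! h
    have h1 : ∀ t : ℝ, 0 ≤ t → u ≤ t * (∑ i ∈ S k, a i + b) := by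
      intro t ht
      have := hφK (fun i => if i ∈ S k then t else 0, t) ⟨Pi.single k t, ?_, ?_, ?_, ?_⟩
      · rw [hφ] at this
        simpa [ite_mul, mul_add, mul_sum] using this
      · intro j; by_cases hj : j = k
        · subst hj; simpa
        · simp [hj]
      · intro j i hi hci
        have : j ≠ k := by rintro rfl; exact hk i hi hci
        simp [this]
      · intro i
        rw [sum_eq_single k]
        · simp
        · intro j _ hj; simp [hj]
        · simp
      · simp
    have h2 : ∑ i ∈ S k, a i + b < 0 := by linarith
    have h3 := h1 ((u - 1) / (∑ i ∈ S k, a i + b)) (div_nonneg_of_nonpos (by linarith) h2.le)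
    rw [div_mul_cancel₀ _ h2.ne] at h3
    linarith
  have hS : ∑ i, c i * a i ≤ M * (-b) := by
    have hs0 : 0 ≤ ∑ i, c i * a i := sum_nonneg fun i _ => mul_nonneg (hc i) (ha i)
    refine le_of_forall_pos_le_add fun η hη => ?_
    set s := ∑ i, c i * a i with hs
    obtain ⟨ε, h0, h1, h2⟩ : ∃ ε : ℝ, 0 < ε ∧ ε < 1 ∧ ε * (s - b) ≤ η := by
      refine ⟨min (1 / 2) (η / (s - b)), ?_, ?_, ?_⟩
      · have : 0 < s - b := by linarith
        positivity
      · exact (min_le_left _ _).trans_lt (by norm_num)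
      · rw [← le_div_iff₀ (by linarith)]; exact min_le_right _ _
    have := hD (fun i => (1 - ε) * c i) (M + ε) (fun i hi => by nlinarith) (by linarith)
    simp only [mul_assoc, ← mul_sum, ← hs] at this
    linarith
  have hl : ∀ i, 0 ≤ if c i = 0 then 1 else a i / (-b) := by
    intro i
    split_ifs
    exacts [zero_le_one, div_nonneg (ha i) (by linarith)]
  refine ⟨fun i => if c i = 0 then 1 else a i / (-b), hl, fun k => ?_, ?_⟩
  · by_cases h : ∃ i ∈ S k, c i = 0
    · obtain ⟨i, hi, hci⟩ := h
      exact le_trans (by simp [hci])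
        (single_le_sum (f := fun i => if c i = 0 then 1 else a i / (-b)) (fun j _ => hl j) hi)
    · push Not at h
      rw [sum_congr rfl fun i hi => if_neg (h i hi), ← sum_div, one_le_div (by linarith)]
      exact hk k h
  · calc ∑ i, c i * (if c i = 0 then 1 else a i / (-b)) = (∑ i, c i * a i) / (-b) := by
          rw [sum_div]
          refine sum_congr rfl fun i _ => ?_
          split_ifs with h <;> simp [h, mul_div_assoc]
      _ ≤ M := by rwa [div_le_iff₀ (by linarith)]

end LinearProgramming

section Cuts

variable {V : Type*} {G : SimpleGraph V} {T : Set V}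

lemma mk_mem_edgeCut_iff {X : Set V} {x y : V} :
    s(x, y) ∈ EdgeCut G X ↔ G.Adj x y ∧ (x ∈ X ∧ y ∉ X ∨ y ∈ X ∧ x ∉ X) := by
  constructor
  · rintro ⟨h, a, b, hab, ha, hb⟩
    refine ⟨h, ?_⟩
    rcases Sym2.eq_iff.1 hab with ⟨rfl, rfl⟩ | ⟨rfl, rfl⟩
    exacts [Or.inl ⟨ha, hb⟩, Or.inr ⟨ha, hb⟩]
  · rintro ⟨h, ⟨hx, hy⟩ | ⟨hy, hx⟩⟩
    exacts [⟨h, x, y, rfl, hx, hy⟩, ⟨h, y, x, Sym2.eq_swap, hy, hx⟩]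

/-- The number of edges of the walk `p` lying in the cut `E(X)`. -/
noncomputable def cutCount (X : Set V) {u w : V} (p : G.Walk u w) : ℕ :=
  p.edges.countP (· ∈ EdgeCut G X)

lemma cutCount_append (X : Set V) {u v w : V} (p : G.Walk u v) (q : G.Walk v w) :
    cutCount X (p.append q) = cutCount X p + cutCount X q := by
  simp [cutCount, Walk.edges_append]

lemma cutCount_reverse (X : Set V) {u v : V} (p : G.Walk u v) :
    cutCount X p.reverse = cutCount X p := by
  simp [cutCount, Walk.edges_reverse]

lemma cutCount_pos {X : Set V} {u v : V} (p : G.Walk u v) (hu : u ∈ X) (hv : v ∉ X) :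
    0 < cutCount X p := by
  induction p with
  | nil => exact absurd hu hv
  | @cons a b c h p ih =>
    by_cases hb : b ∈ X
    · exact (ih hb hv).trans_le (by simp [cutCount, List.countP_cons])
    · simp [cutCount, mk_mem_edgeCut_iff, h, hu, hb]

lemma cutCount_singleton_eq_zero {t u v : V} (p : G.Walk u v) (ht : t ∉ p.support) :
    cutCount {t} p = 0 := by
  simp only [cutCount, List.countP_eq_zero, decide_eq_true_eq]
  rintro e he ⟨_, x, y, rfl, rfl, _⟩
  exact ht (p.fst_mem_support_of_mem_edges he)

lemma cutCount_singleton_le_of_start {X : Set V} {t w : V} (p : G.Walk t w) (hp : p.IsPath)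
    (ht : t ∈ X) (hw : w = t ∨ w ∉ X) : cutCount {t} p ≤ cutCount X p := by
  cases p with
  | nil => simp [cutCount]
  | cons h p =>
    rw [Walk.cons_isPath_iff] at hp
    have hwt : w ≠ t := by rintro rfl; exact hp.2 p.end_mem_support
    have h0 := cutCount_singleton_eq_zero p hp.2
    have h1 := cutCount_pos (Walk.cons h p) ht (hw.resolve_left hwt)
    have h2 : cutCount {t} (Walk.cons h p) ≤ cutCount {t} p + 1 := by
      simp only [cutCount, Walk.edges_cons, List.countP_cons]
      split_ifs <;> simp
    omega

lemma cutCount_singleton_le {X : Set V} {t : V} (hX : X ∩ T = {t})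
    {P : Σ u : V, Σ w : V, G.Walk u w} (hP : IsTPath G T P) :
    cutCount {t} P.2.2 ≤ cutCount X P.2.2 := by
  obtain ⟨u, w, p⟩ := P
  obtain ⟨hu, hw, -, hp⟩ := hP
  simp only at hu hw hp ⊢
  have htX : t ∈ X := (hX.symm ▸ Set.mem_singleton t : t ∈ X ∩ T).1
  have key : ∀ v ∈ T, v = t ∨ v ∉ X := fun v hv =>
    or_iff_not_imp_right.2 fun h => (hX ▸ ⟨not_not.1 h, hv⟩ : v ∈ ({t} : Set V))
  by_cases ht : t ∈ p.support
  · rw [← p.take_spec ht, cutCount_append, cutCount_append, ← cutCount_reverse _ (p.takeUntil t ht),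
      ← cutCount_reverse X (p.takeUntil t ht)]
    exact add_le_add
      (cutCount_singleton_le_of_start _ (hp.takeUntil ht).reverse htX (key u hu))
      (cutCount_singleton_le_of_start _ (hp.dropUntil ht) htX (key w hw))
  · simp [cutCount_singleton_eq_zero p ht]

variable [Fintype V]

instance finite_tPaths : Finite {P : Σ u : V, Σ w : V, G.Walk u w // IsTPath G T P} := by
  refine Finite.of_injective
    (β := Σ u : V, Σ w : V, G.Path u w) (fun P => ⟨P.1.1, P.1.2.1, P.1.2.2, P.2.2.2.2⟩) ?_
  rintro ⟨⟨u, w, p⟩, hp⟩ ⟨⟨u', w', p'⟩, hp'⟩ h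
  simp only [Sigma.mk.injEq] at h
  obtain ⟨rfl, h⟩ := h
  simp only [heq_eq_eq, Sigma.mk.injEq] at h
  obtain ⟨rfl, h⟩ := h
  simp only [heq_eq_eq, Subtype.mk.injEq] at h
  subst h
  rfl

noncomputable instance fintypeTPaths :
    Fintype {P : Σ u : V, Σ w : V, G.Walk u w // IsTPath G T P} := Fintype.ofFinite _

lemma cutVal_eq_sum (X : Set V) (h : Sym2 V → NNReal) :
    cutVal G X h = ∑ e, if e ∈ EdgeCut G X then h e else 0 := by
  rw [cutVal, finsum_mem_def, finsum_eq_sum_of_fintype]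
  rfl

lemma finsum_tPaths_eq_sum (g : (Σ u : V, Σ w : V, G.Walk u w) → NNReal) (e : Sym2 V) :
    ∑ᶠ P ∈ {P : Σ u : V, Σ w : V, G.Walk u w | IsTPath G T P ∧ e ∈ P.2.2.edges}, g P =
      ∑ P : {P : Σ u : V, Σ w : V, G.Walk u w // IsTPath G T P},
        if e ∈ P.1.2.2.edges then g P.1 else 0 := by
  rw [← finsum_eq_sum_of_fintype]
  refine Eq.trans ?_ (finsum_set_coe_eq_finsum_mem
    (f := fun P : Σ u : V, Σ w : V, G.Walk u w => if e ∈ P.2.2.edges then g P else 0)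
    {P | IsTPath G T P}).symm
  refine finsum_congr fun P => ?_
  rw [finsum_eq_if, finsum_eq_if]
  by_cases h : IsTPath G T P <;> simp [h]

lemma sum_edgeCut_eq_cutCount (X : Set V) {u w : V} {p : G.Walk u w} (hp : p.IsPath) :
    (∑ e, if e ∈ EdgeCut G X ∧ e ∈ p.edges then 1 else 0) = cutCount X p := by
  rw [cutCount, List.countP_eq_length_filter,
    ← List.toFinset_card_of_nodup (hp.isTrail.edges_nodup.filter _), ← card_filter]
  congr 1
  ext e
  simp [and_comm]

lemma IsDecomposition.cutVal_eq {f : Sym2 V → NNReal}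
    {g : (Σ u : V, Σ w : V, G.Walk u w) → NNReal} (hg : IsDecomposition G T f g) (X : Set V) :
    cutVal G X f = ∑ P : {P : Σ u : V, Σ w : V, G.Walk u w // IsTPath G T P},
      g P.1 * cutCount X P.1.2.2 := by
  have : ∀ P : {P : Σ u : V, Σ w : V, G.Walk u w // IsTPath G T P},
      g P.1 * cutCount X P.1.2.2 =
        ∑ e, if e ∈ EdgeCut G X then (if e ∈ P.1.2.2.edges then g P.1 else 0) else 0 := by
    intro P
    rw [← sum_edgeCut_eq_cutCount X P.2.2.2.2, Nat.cast_sum, mul_sum]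
    refine sum_congr rfl fun e _ => ?_
    by_cases h1 : e ∈ EdgeCut G X <;> by_cases h2 : e ∈ P.1.2.2.edges <;> simp [h1, h2]
  rw [cutVal_eq_sum, sum_congr rfl fun P _ => this P, sum_comm]
  refine sum_congr rfl fun e _ => ?_
  split_ifs with h
  · rw [hg.2 e h.1, finsum_tPaths_eq_sum]
  · simp

lemma finsum_mem_eq_sum_ite {M : Type*} [AddCommMonoid M] (a : V → M) :
    ∑ᶠ t ∈ T, a t = ∑ t, if t ∈ T then a t else 0 := by
  rw [finsum_mem_def, finsum_eq_sum_of_fintype]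
  rfl

/-- Weak duality between feasible multiflows and cut-systems. -/
lemma flowValue_le_gammaVal {c f : Sym2 V → NNReal} (hf : IsMultiflow G T f)
    (hfc : FeasibleFlow G c f) {𝒳 : V → Set V} (h𝒳 : IsCutSystem G T 𝒳) :
    flowValue G T f ≤ gammaVal G T c 𝒳 / 2 := by
  obtain ⟨g, hg⟩ := hf
  rw [flowValue, gammaVal, finsum_mem_eq_sum_ite, finsum_mem_eq_sum_ite]
  refine div_le_div_of_nonneg_right (sum_le_sum fun t _ => ?_) zero_le_two
  split_ifs with ht
  · calc cutVal G {t} f ≤ cutVal G (𝒳 t) f := by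
          rw [hg.cutVal_eq, hg.cutVal_eq]
          refine sum_le_sum fun P _ => mul_le_mul_right ?_ _
          exact_mod_cast cutCount_singleton_le (h𝒳.1 t ht).1 P.2
      _ ≤ cutVal G (𝒳 t) c := by
          rw [cutVal_eq_sum, cutVal_eq_sum]
          refine sum_le_sum fun e _ => ?_
          split_ifs with he
          exacts [hfc e he.1, le_rfl]
  · exact le_rfl

lemma IsDecomposition.sum_le_flowValue {f : Sym2 V → NNReal}
    {g : (Σ u : V, Σ w : V, G.Walk u w) → NNReal} (hg : IsDecomposition G T f g) :
    ∑ P : {P : Σ u : V, Σ w : V, G.Walk u w // IsTPath G T P}, g P.1 ≤ flowValue G T f := by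
  rw [flowValue, le_div_iff₀ two_pos, finsum_mem_eq_sum_ite, ← sum_filter,
    sum_congr rfl fun t _ => hg.cutVal_eq {t}, sum_comm, sum_mul]
  refine sum_le_sum fun P _ => ?_
  rw [← mul_sum]
  refine mul_le_mul_right ?_ _
  obtain ⟨⟨u, w, p⟩, hu, hw, huw, hp⟩ := P
  simp only at hu hw huw hp ⊢
  have h1 : 0 < cutCount {u} p := cutCount_pos p rfl huw.symm
  have h2 : 0 < cutCount {w} p := by
    rw [← cutCount_reverse]
    exact cutCount_pos p.reverse rfl huw
  have h3 : ∑ t ∈ ({u, w} : Finset V), cutCount {t} p ≤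
      ∑ t with t ∈ T, cutCount {t} p :=
    sum_le_sum_of_subset (by intro x; simp only [mem_insert, mem_singleton]; rintro (rfl | rfl) <;> simpa)
  rw [sum_pair huw] at h3
  exact_mod_cast (by omega : 2 ≤ ∑ t with t ∈ T, cutCount {t} p)

end Cuts

section Potentials

variable {V : Type*} {G : SimpleGraph V} {T : Set V} {l : Sym2 V → ℝ}

/-- The total `l`-length of the edges of a walk. -/
noncomputable def walkLength (l : Sym2 V → ℝ) {u v : V} (p : G.Walk u v) : ℝ :=
  (p.edges.map l).sum

lemma walkLength_nonneg (hl : ∀ e, 0 ≤ l e) {u v : V} (p : G.Walk u v) : 0 ≤ walkLength l p :=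
  List.sum_nonneg (by simpa using fun e _ => hl e)

lemma walkLength_append {u v w : V} (p : G.Walk u v) (q : G.Walk v w) :
    walkLength l (p.append q) = walkLength l p + walkLength l q := by
  simp [walkLength, Walk.edges_append]

lemma walkLength_reverse {u v : V} (p : G.Walk u v) : walkLength l p.reverse = walkLength l p := by
  simp [walkLength, Walk.edges_reverse]

lemma walkLength_bypass_le (hl : ∀ e, 0 ≤ l e) {u v : V} (p : G.Walk u v) :
    walkLength l p.bypass ≤ walkLength l p := by
  refine List.Sublist.sum_le_sum ((p.edges_bypass_sublist_edges).map l) ?_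
  simpa using fun e _ => hl e

variable (G) in
/-- The distance from `t` to `v` with respect to the edge lengths `l`, truncated at `1 / 2`. -/
noncomputable def halfDist (l : Sym2 V → ℝ) (t v : V) : ℝ :=
  ⨅ o : Option (G.Walk t v), o.elim (1 / 2) (walkLength l)

lemma bddBelow_halfDist (hl : ∀ e, 0 ≤ l e) (t v : V) :
    BddBelow (Set.range fun o : Option (G.Walk t v) => o.elim (1 / 2) (walkLength l)) := by
  refine ⟨0, ?_⟩
  rintro _ ⟨_ | p, rfl⟩
  exacts [by norm_num, walkLength_nonneg hl p]

lemma halfDist_le_half (hl : ∀ e, 0 ≤ l e) (t v : V) : halfDist G l t v ≤ 1 / 2 :=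
  ciInf_le (bddBelow_halfDist hl t v) none

lemma halfDist_le_walkLength (hl : ∀ e, 0 ≤ l e) {t v : V} (p : G.Walk t v) :
    halfDist G l t v ≤ walkLength l p :=
  ciInf_le (bddBelow_halfDist hl t v) (some p)

lemma halfDist_nonneg (hl : ∀ e, 0 ≤ l e) (t v : V) : 0 ≤ halfDist G l t v := by
  refine le_ciInf ?_
  rintro (_ | p)
  exacts [by norm_num, walkLength_nonneg hl p]

lemma halfDist_self (hl : ∀ e, 0 ≤ l e) (t : V) : halfDist G l t t = 0 :=
  le_antisymm (by simpa [walkLength] using halfDist_le_walkLength hl (Walk.nil : G.Walk t t))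
    (halfDist_nonneg hl t t)

lemma exists_walkLength_lt {t v : V} {r : ℝ} (hr : r ≤ 1 / 2) (h : halfDist G l t v < r) :
    ∃ p : G.Walk t v, walkLength l p < r := by
  obtain ⟨_ | p, hp⟩ := exists_lt_of_ciInf_lt h
  exacts [absurd hp (not_lt.2 hr), ⟨p, hp⟩]

lemma halfDist_le_add (hl : ∀ e, 0 ≤ l e) (t : V) {u v : V} (h : G.Adj u v) :
    halfDist G l t v ≤ halfDist G l t u + l s(u, v) := by
  rw [← sub_le_iff_le_add]
  refine le_ciInf ?_
  rintro (_ | p)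
  · have := halfDist_le_half hl t v (G := G)
    have := hl s(u, v)
    simp only [Option.elim_none]
    linarith
  · have := halfDist_le_walkLength hl (p.append h.toWalk)
    rw [walkLength_append] at this
    simp only [Option.elim_some]
    simpa [walkLength] using this

/-- Every walk between two distinct terminals has length at least `1`. -/
def SeparatesTerminals (G : SimpleGraph V) (T : Set V) (l : Sym2 V → ℝ) : Prop :=
  ∀ s ∈ T, ∀ t ∈ T, s ≠ t → ∀ p : G.Walk s t, 1 ≤ walkLength l p

lemma one_le_halfDist_add (hT : SeparatesTerminals G T l) {s t u v : V}
    (hs : s ∈ T) (ht : t ∈ T) (hst : s ≠ t) (q : G.Walk u v) (hu : halfDist G l s u < 1 / 2)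
    (hv : halfDist G l t v < 1 / 2) :
    1 ≤ halfDist G l s u + walkLength l q + halfDist G l t v := by
  by_contra! h
  set ε := (1 - (halfDist G l s u + walkLength l q + halfDist G l t v)) / 2 with hε
  obtain ⟨p, hp⟩ := exists_walkLength_lt (r := min (1 / 2) (halfDist G l s u + ε))
    (min_le_left _ _) (lt_min hu (by linarith))
  obtain ⟨p', hp'⟩ := exists_walkLength_lt (r := min (1 / 2) (halfDist G l t v + ε))
    (min_le_left _ _) (lt_min hv (by linarith))
  have := hT s hs t ht hst ((p.append q).append p'.reverse)
  rw [walkLength_append, walkLength_append, walkLength_reverse] at this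
  have := hp.trans_le (min_le_right _ _)
  have := hp'.trans_le (min_le_right _ _)
  linarith

lemma eq_of_halfDist_lt (hT : SeparatesTerminals G T l) {s t v : V}
    (hs : s ∈ T) (ht : t ∈ T) (h1 : halfDist G l s v < 1 / 2) (h2 : halfDist G l t v < 1 / 2) :
    s = t := by
  by_contra hst
  have := one_le_halfDist_add hT hs ht hst Walk.nil h1 h2
  simp only [walkLength, Walk.edges_nil, List.map_nil, List.sum_nil] at this
  linarith

lemma sum_abs_halfDist_sub_le [Fintype V] (hl : ∀ e, 0 ≤ l e) (hT : SeparatesTerminals G T l)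
    {u v : V} (h : G.Adj u v) :
    ∑ t with t ∈ T, |halfDist G l t v - halfDist G l t u| ≤ l s(u, v) := by
  have habs : ∀ t, |halfDist G l t v - halfDist G l t u| ≤ l s(u, v) := by
    intro t
    have h1 := halfDist_le_add hl t h
    have h2 := halfDist_le_add hl t h.symm
    rw [Sym2.eq_swap] at h2
    exact abs_le.2 ⟨by linarith, by linarith⟩
  have hhalf : ∀ t w, ¬ halfDist G l t w < 1 / 2 → halfDist G l t w = 1 / 2 := fun t w hw =>
    le_antisymm (halfDist_le_half hl t w) (not_lt.1 hw)
  have single : ∀ s ∈ T, (∀ t ∈ T, t ≠ s → ¬ halfDist G l t u < 1 / 2 ∧ ¬ halfDist G l t v < 1 / 2) →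
      ∑ t with t ∈ T, |halfDist G l t v - halfDist G l t u| ≤ l s(u, v) := by
    intro s hs hst
    rw [sum_eq_single_of_mem s (by simpa)]
    · exact habs s
    · intro t ht hne
      obtain ⟨h1, h2⟩ := hst t (by simpa using ht) hne
      rw [hhalf _ _ h1, hhalf _ _ h2, sub_self, abs_zero]
  by_cases hu : ∃ s ∈ T, halfDist G l s u < 1 / 2
  · obtain ⟨s, hs, hsu⟩ := hu
    by_cases hv : ∃ t ∈ T, t ≠ s ∧ halfDist G l t v < 1 / 2
    · obtain ⟨t, ht, hts, htv⟩ := hv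
      have hsv : ¬ halfDist G l s v < 1 / 2 := fun h => hts (eq_of_halfDist_lt hT ht hs htv h)
      have htu : ¬ halfDist G l t u < 1 / 2 := fun h => hts (eq_of_halfDist_lt hT ht hs h hsu)
      rw [sum_eq_add_of_mem s t (by simpa) (by simpa) hts.symm]
      · have := one_le_halfDist_add hT hs ht hts.symm h.toWalk hsu htv
        rw [hhalf _ _ hsv, hhalf _ _ htu, abs_of_pos (by linarith), abs_of_neg (by linarith)]
        simp only [walkLength, Walk.edges_cons, Walk.edges_nil, List.map_cons, List.map_nil,
          List.sum_cons, List.sum_nil, Adj.toWalk] at this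
        linarith
      · rintro r hr ⟨hrs, hrt⟩
        have hr : r ∈ T := by simpa using hr
        rw [hhalf r v fun h => hrt (eq_of_halfDist_lt hT hr ht h htv),
          hhalf r u fun h => hrs (eq_of_halfDist_lt hT hr hs h hsu), sub_self, abs_zero]
    · push Not at hv
      exact single s hs fun t ht hts =>
        ⟨fun h => hts (eq_of_halfDist_lt hT ht hs h hsu), not_lt.2 (hv t ht hts)⟩
  · push Not at hu
    by_cases hv : ∃ t ∈ T, halfDist G l t v < 1 / 2
    · obtain ⟨s, hs, hsv⟩ := hv
      exact single s hs fun t ht hts =>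
        ⟨not_lt.2 (hu t ht), fun h => hts (eq_of_halfDist_lt hT ht hs h hsv)⟩
    · push Not at hv
      refine (sum_eq_zero fun t ht => ?_).trans_le (hl _)
      have ht : t ∈ T := by simpa using ht
      rw [hhalf _ _ (not_lt.2 (hu t ht)), hhalf _ _ (not_lt.2 (hv t ht)), sub_self, abs_zero]

lemma isCutSystem_halfDist (hl : ∀ e, 0 ≤ l e) (hT : SeparatesTerminals G T l) {r : ℝ}
    (hr0 : 0 < r) (hr : r ≤ 1 / 2) : IsCutSystem G T fun t => {v | halfDist G l t v < r} := by
  refine ⟨fun t ht => ⟨?_, ?_⟩, fun t ht t' ht' hne => ?_⟩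
  · ext v
    simp only [Set.mem_inter_iff, Set.mem_ofPred_eq, Set.mem_singleton_iff]
    constructor
    · rintro ⟨hv, hvT⟩
      exact eq_of_halfDist_lt hT hvT ht (by rw [halfDist_self hl]; norm_num) (hv.trans_le hr)
    · rintro rfl
      exact ⟨by rwa [halfDist_self hl], ht⟩
  · rw [connected_iff_exists_forall_reachable]
    refine ⟨⟨t, by simpa [halfDist_self hl] using hr0⟩, ?_⟩
    rintro ⟨v, hv⟩
    obtain ⟨p, hp⟩ := exists_walkLength_lt hr hv
    refine ⟨p.induce _ fun w hw => ?_⟩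
    have h1 := halfDist_le_walkLength hl (p.takeUntil w hw)
    have h2 := walkLength_nonneg hl (p.dropUntil w hw)
    rw [← p.take_spec hw, walkLength_append] at hp
    simp only [Set.mem_ofPred_eq]
    linarith
  · ext v
    simp only [Set.mem_inter_iff, Set.mem_ofPred_eq, Set.mem_empty_iff_false, iff_false]
    rintro ⟨h1, h2⟩
    exact hne (eq_of_halfDist_lt hT ht ht' (h1.trans_le hr) (h2.trans_le hr))

open MeasureTheory in
/-- Averaging over balls of radius at most `1 / 2` turns terminal-separating edge lengths into a
cut-system. -/
lemma exists_cutSystem_of_separatesTerminals [Fintype V] (hl : ∀ e, 0 ≤ l e)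
    (hT : SeparatesTerminals G T l) (c : Sym2 V → NNReal) :
    ∃ 𝒳, IsCutSystem G T 𝒳 ∧ (gammaVal G T c 𝒳 : ℝ) ≤ 2 * ∑ e, (c e : ℝ) * l e := by
  obtain ⟨x, hx⟩ : ∃ x : Sym2 V → V × V, ∀ e, e = s((x e).1, (x e).2) :=
    ⟨fun e => e.out, fun e => (Quot.out_eq e).symm⟩
  let I : V → Sym2 V → Set ℝ := fun t e =>
    Set.uIoc (halfDist G l t (x e).1) (halfDist G l t (x e).2)
  let F : ℝ → ℝ := fun r => ∑ e with e ∈ G.edgeSet, ∑ t with t ∈ T,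
    (I t e).indicator (fun _ => (c e : ℝ)) r
  have hγ : ∀ r, (gammaVal G T c (fun t => {v | halfDist G l t v < r}) : ℝ) = F r := by
    intro r
    rw [gammaVal, finsum_mem_eq_sum_ite, ← sum_filter]
    simp only [cutVal_eq_sum, NNReal.coe_sum, F]
    rw [sum_comm, sum_filter]
    refine sum_congr rfl fun e _ => ?_
    have hmem : ∀ t, e ∈ EdgeCut G {v | halfDist G l t v < r} ↔ e ∈ G.edgeSet ∧ r ∈ I t e := by
      intro t
      simp only [I]
      rw [hx e, mk_mem_edgeCut_iff, ← hx e, Set.mem_uIoc]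
      conv_rhs => rw [hx e, mem_edgeSet, ← hx e]
      simp [not_lt]
    simp only [hmem]
    split_ifs with he
    · refine sum_congr rfl fun t _ => ?_
      by_cases hr : r ∈ I t e <;> simp [he, hr]
    · simp [he]
  have hint : ∀ t e, IntegrableOn ((I t e).indicator fun _ => (c e : ℝ)) (Set.Ioc 0 (1 / 2)) :=
    fun t e => (integrableOn_const (by simp)).indicator measurableSet_uIoc
  have hF : IntegrableOn F (Set.Ioc 0 (1 / 2)) :=
    integrable_finsetSum _ fun e _ => integrable_finsetSum _ fun t _ => hint t e
  obtain ⟨r, hr, hFr⟩ := exists_le_setAverage (μ := volume) (s := Set.Ioc (0 : ℝ) (1 / 2))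
    (by simp) (by simp) hF
  refine ⟨_, isCutSystem_halfDist hl hT hr.1 hr.2, (hγ r).trans_le (hFr.trans ?_)⟩
  have hIF : ∫ r in Set.Ioc (0 : ℝ) (1 / 2), F r ≤ ∑ e, (c e : ℝ) * l e := by
    simp only [F]
    rw [integral_finsetSum _ fun e _ => integrable_finsetSum _ fun t _ => hint t e]
    calc _ ≤ ∑ e with e ∈ G.edgeSet, (c e : ℝ) * l e := by
          refine sum_le_sum fun e he => ?_
          rw [integral_finsetSum _ fun t _ => hint t e]
          have he : G.Adj (x e).1 (x e).2 := by
            rw [← mem_edgeSet, ← hx e]; simpa using he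
          have := sum_abs_halfDist_sub_le hl hT he
          rw [← hx e] at this
          refine le_trans (sum_le_sum fun t _ => ?_)
            ((mul_sum _ _ _).symm.trans_le (mul_le_mul_of_nonneg_left this (c e).2))
          rw [setIntegral_indicator measurableSet_uIoc, setIntegral_const, smul_eq_mul, mul_comm]
          refine mul_le_mul_of_nonneg_left ?_ (c e).2
          refine (measureReal_mono Set.inter_subset_right (by simp)).trans_eq ?_
          simp [Measure.real]
      _ ≤ ∑ e, (c e : ℝ) * l e :=
          sum_le_sum_of_subset_of_nonneg (filter_subset _ _) fun e _ _ =>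
            mul_nonneg (c e).2 (hl e)
  rw [setAverage_eq, smul_eq_mul]
  have : (volume.real (Set.Ioc (0 : ℝ) (1 / 2)))⁻¹ = 2 := by norm_num
  rw [this]
  linarith

end Potentials

/-- Strong duality: a maximum multiflow is matched by some cut-system. -/
lemma exists_gammaVal_le_of_isMaximum {V : Type*} [Fintype V] {G : SimpleGraph V} {T : Set V}
    {c f : Sym2 V → NNReal}
    (hmax : ∀ f', IsMultiflow G T f' → FeasibleFlow G c f' → flowValue G T f' ≤ flowValue G T f) :
    ∃ 𝒳, IsCutSystem G T 𝒳 ∧ gammaVal G T c 𝒳 / 2 ≤ flowValue G T f := by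
  obtain ⟨l, hl, hcover, hval⟩ := exists_fractional_cover
    (fun P : {P : Σ u : V, Σ w : V, G.Walk u w // IsTPath G T P} => P.1.2.2.edges.toFinset)
    (fun e => (c e : ℝ)) (fun e => (c e).2) (flowValue G T f) (by
      intro g hg0 hgc
      let g' : (Σ u : V, Σ w : V, G.Walk u w) → NNReal := fun P =>
        if h : IsTPath G T P then (g ⟨P, h⟩).toNNReal else 0
      let f' : Sym2 V → NNReal := fun e =>
        ∑ᶠ P ∈ {P : Σ u : V, Σ w : V, G.Walk u w | IsTPath G T P ∧ e ∈ P.2.2.edges}, g' P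
      have hg' : ∀ P : {P : Σ u : V, Σ w : V, G.Walk u w // IsTPath G T P},
          (g' P.1 : ℝ) = g P := fun P => by simp [g', P.2, hg0]
      have hdec : IsDecomposition G T f' g' :=
        ⟨fun P hP => by by_contra h; simp [g', h] at hP, fun e _ => rfl⟩
      have hfeas : FeasibleFlow G c f' := by
        intro e _
        rw [← NNReal.coe_le_coe]
        refine le_trans (le_of_eq ?_) (hgc e)
        simp only [f', finsum_tPaths_eq_sum, NNReal.coe_sum]
        refine sum_congr rfl fun P _ => ?_
        by_cases h : e ∈ P.1.2.2.edges <;> simp [h, hg']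
      have := hdec.sum_le_flowValue.trans (hmax f' ⟨g', hdec⟩ hfeas)
      rw [← NNReal.coe_le_coe, NNReal.coe_sum] at this
      simpa [hg'] using this)
  have hsep : SeparatesTerminals G T l := by
    intro s hs t ht hst p
    refine le_trans ?_ (walkLength_bypass_le hl p)
    have := hcover ⟨⟨s, t, p.bypass⟩, hs, ht, hst, p.bypass_isPath⟩
    rwa [List.sum_toFinset _ p.bypass_isPath.isTrail.edges_nodup] at this
  obtain ⟨𝒳, h𝒳, hle⟩ := exists_cutSystem_of_separatesTerminals hl hsep c
  refine ⟨𝒳, h𝒳, ?_⟩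
  rw [← NNReal.coe_le_coe]
  push_cast
  linarith

/-- Cherkasskii: a feasible multiflow `f` in `(G,T,c)` is maximum
(i.e., maximizes `α` among feasible multiflows) if and only if there exists a
cut-system `𝒳` of `T` such that `α(f) = ½·γ(𝒳)`. -/
theorem isMaximum_iff_exists_cutSystem {V : Type*} [Fintype V] [DecidableEq V]
    (G : SimpleGraph V) (T : Set V) (hT : 2 ≤ T.ncard)
    (c f : Sym2 V → NNReal) (hf : IsMultiflow G T f) (hfc : FeasibleFlow G c f) :
    (∀ f', IsMultiflow G T f' → FeasibleFlow G c f' → flowValue G T f' ≤ flowValue G T f) ↔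
    ∃ 𝒳 : V → Set V, IsCutSystem G T 𝒳 ∧ flowValue G T f = gammaVal G T c 𝒳 / 2 := by
  constructor
  · intro hmax
    obtain ⟨𝒳, h𝒳, hle⟩ := exists_gammaVal_le_of_isMaximum hmax
    exact ⟨𝒳, h𝒳, le_antisymm (flowValue_le_gammaVal hf hfc h𝒳) hle⟩
  · rintro ⟨𝒳, h𝒳, heq⟩ f' hf' hfc'
    exact heq ▸ flowValue_le_gammaVal hf' hfc' h𝒳
end

section
/- For a feasible flow f in a rooted tree instance I(e) and any vertex s ∈ V_e, the set V_f(s) induces a connected subgraph of G_e; the parent-edge e' of V_f(s) (if it exists) satisfies f(e') = c(e'); and every child-edge e' of V_f(s) satisfies f(e') ∈ {c(e')−1, c(e')}. -/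
open Classical

/-- `⟨a,b⟩`: the set `{a, a+2, …, b}` of consecutive odd or even integers. -/
def Iv (a b : ℕ) : Set ℕ := {x | a ≤ x ∧ x ≤ b ∧ x % 2 = a % 2}

/-- `A ⊗ B = {a + b − 2i : a ∈ A, b ∈ B, 0 ≤ i ≤ min(a,b)}`. -/
def otimes (A B : Set ℕ) : Set ℕ :=
  {x | ∃ a ∈ A, ∃ b ∈ B, ∃ i, i ≤ min a b ∧ x = a + b - 2 * i}

/-- A tree instance `(G,T,c)` rooted at a terminal `r`: a tree on vertex set `V`,
encoded by the parent function `par` (with `par root = root`) together with a depth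
function certifying acyclicity.  Each non-root vertex `v` is identified with the edge
`(par v, v)`; `c v` is the (positive integer) capacity of that edge.  The terminals are
the leaves; the root has exactly one child and every internal vertex has exactly
two children (total degree 3). -/
structure RTI (V : Type*) where
  root : V
  par : V → V
  dep : V → ℕ
  c : V → ℕ
  par_root : par root = root
  dep_root : dep root = 0
  dep_par : ∀ v, v ≠ root → dep v = dep (par v) + 1
  cap_pos : ∀ v, v ≠ root → 1 ≤ c v
  root_degree : {w : V | par w = root ∧ w ≠ root}.ncard = 1
  internal_degree : ∀ v, v ≠ root → {w : V | par w = v ∧ w ≠ root}.Nonempty →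
    {w : V | par w = v ∧ w ≠ root}.ncard = 2

namespace RTI

variable {V : Type*} (R : RTI V)

/-- `R.below u v`: `v` lies in the subtree rooted at `u` (i.e. `u` is an ancestor of
`v`, allowing `u = v`). -/
def below (u v : V) : Prop :=
  Relation.ReflTransGen (fun a b => R.par b = a ∧ b ≠ R.root) u v

/-- `v` is a leaf of the tree other than the root. -/
def leaf (v : V) : Prop := v ≠ R.root ∧ ∀ w, w ≠ R.root → R.par w ≠ v

/-- The children of `v` (as lower endpoints of child-edges). -/
def children (v : V) : Set V := {w | R.par w = v ∧ w ≠ R.root}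

/-- For an edge `e = (par v, v)`, the vertex set `V_e` of the instance `I(e)`. -/
def Ve (v : V) : Set V := insert (R.par v) {w | R.below v w}

/-- `T_e`: the terminals of `I(e)` other than `u = par v`. -/
def Te (v : V) : Set V := {w | R.below v w ∧ R.leaf w}

/-- The full terminal set `T_e ∪ {u}` of the instance `I(e)`. -/
def S (v : V) : Set V := insert (R.par v) (R.Te v)

/-- The edge `(par x, x)` lies on the tree path between `t` and `t'`
(exactly one of `t, t'` is in the subtree below `x`). -/
def onPath (x t t' : V) : Prop :=
  (R.below x t ∧ ¬ R.below x t') ∨ (¬ R.below x t ∧ R.below x t')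

/-- The vertex `x` lies on the tree path between `t` and `t'`. -/
def onPathV (x t t' : V) : Prop :=
  (R.below x t ∨ R.below x t') ∧ ∀ z, R.below z t → R.below z t' → R.below z x

/-- Unordered pairs of distinct terminals of the instance `I(e)` for `e = (par v, v)`. -/
def PathPairs (v : V) : Set (Sym2 V) :=
  {p | ∃ t t', t ∈ R.S v ∧ t' ∈ R.S v ∧ t ≠ t' ∧ p = s(t, t')}

/-- `g` is a decomposition of `f` in the instance `I(e)`, `e = (par v, v)`:
`g` is supported on pairs of distinct terminals and, on every edge of `I(e)`,
`f` is the sum of `g` over the (unique) terminal-pair paths through that edge. -/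
def IsDecomp (v : V) (f : V → ℕ) (g : Sym2 V → ℕ) : Prop :=
  (∀ p, g p ≠ 0 → p ∈ R.PathPairs v) ∧
  ∀ w, R.below v w →
    f w = ∑ᶠ p ∈ {p : Sym2 V | ∃ t t', p = s(t, t') ∧ R.onPath w t t'}, g p

/-- `f` is an (integral) flow in the instance `I(e)`, `e = (par v, v)`. -/
def IsFlow (v : V) (f : V → ℕ) : Prop := ∃ g, R.IsDecomp v f g

/-- `f` is feasible in `I(e)`. -/
def Feasible (v : V) (f : V → ℕ) : Prop := ∀ w, R.below v w → f w ≤ R.c w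

/-- `V_f(s)`: the set of vertices `w` of `I(e)` reachable from `s` by travelling
upward along edges with `c − f ≥ 1` to a common ancestor and then downward along
edges with `c − f ≥ 2`. -/
def Vf (v : V) (f : V → ℕ) (s : V) : Set V :=
  {w | w ∈ R.Ve v ∧ ∃ z ∈ R.Ve v, R.below z s ∧ R.below z w ∧
    (∀ x, R.below z x → R.below x s → x ≠ z → f x + 1 ≤ R.c x) ∧
    (∀ x, R.below z x → R.below x w → x ≠ z → f x + 2 ≤ R.c x)}

/-- `W` induces a connected subgraph of the tree (it is closed under tree paths). -/
def ConnSet (W : Set V) : Prop :=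
  ∀ w₁ ∈ W, ∀ w₂ ∈ W, ∀ x, R.onPathV x w₁ w₂ → x ∈ W

/-- `E(X)` inside the instance `I(e)`, `e = (par v, v)`: the edges `(par x, x)` of
`I(e)` with exactly one endpoint in `X`. -/
def cutE (v : V) (X : Set V) : Set V :=
  {x | R.below v x ∧ ¬ (x ∈ X ↔ R.par x ∈ X)}

/-- `h(X) = Σ_{e' ∈ E(X)} h(e')` inside the instance `I(e)`, `e = (par v, v)`. -/
noncomputable def hval (v : V) (X : Set V) (h : V → ℕ) : ℕ := ∑ᶠ x ∈ R.cutE v X, h x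

/-- `W` is a connected component of the subgraph of `I(e)` induced by `A`. -/
def IsComp (v : V) (A W : Set V) : Prop :=
  W.Nonempty ∧ W ⊆ A ∧ R.ConnSet W ∧
  (∀ x, R.below v x → x ∈ W → R.par x ∈ A → R.par x ∈ W) ∧
  (∀ x, R.below v x → R.par x ∈ W → x ∈ A → x ∈ W)

/-- `odd(X)` (relative to the union `U` of the removed terminal sets): the components
`W` of `G_e − U` with `c(W)` odd whose parent-edge is a child-edge of `X`. -/
def oddOf (v : V) (U X : Set V) : Set (Set V) :=
  {W | R.IsComp v (R.Ve v \ U) W ∧ Odd (R.hval v W R.c) ∧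
    ∃ y ∈ W, R.par y ∉ W ∧ R.par y ∈ X}

/-- The union of the sets `V_f(t)`, `t ∈ T_e`. -/
def UT (v : V) (f : V → ℕ) : Set V := ⋃ t ∈ R.Te v, R.Vf v f t

/-- The union of the sets `V_f(t)`, `t ∈ T_e ∪ {u}`. -/
def USall (v : V) (f : V → ℕ) : Set V := ⋃ t ∈ R.S v, R.Vf v f t

/-- `f` is a blocking flow in `I(e)`, `e = (par v, v)`: a feasible flow such that
`{V_f(t) : t ∈ T_e}` is a cut-system of `T_e` (pairwise disjoint `t`-sets avoiding the
terminal `u = par v`) each member of which is blocked by `f`, i.e.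
`f(e_t) = f(V_f(t)) = c(V_f(t)) − |odd(V_f(t))|`. -/
def IsBlocking (v : V) (f : V → ℕ) : Prop :=
  R.IsFlow v f ∧ R.Feasible v f ∧
  (∀ t ∈ R.Te v, R.par v ∉ R.Vf v f t) ∧
  (∀ t ∈ R.Te v, ∀ t' ∈ R.Te v, t ≠ t' → R.Vf v f t ∩ R.Vf v f t' = ∅) ∧
  (∀ t ∈ R.Te v, f t = R.hval v (R.Vf v f t) f ∧
    R.hval v (R.Vf v f t) f + (R.oddOf v (R.UT v f) (R.Vf v f t)).ncard
      = R.hval v (R.Vf v f t) R.c)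

/-- `Ψ(e)`: the set of values `f(e)` of blocking flows `f` of `I(e)`, `e = (par v, v)`. -/
def Psi (v : V) : Set ℕ := {x | ∃ f, R.IsBlocking v f ∧ f v = x}

/-- `a(e)`: the least element of `Ψ(e)`. -/
noncomputable def aE (v : V) : ℕ := sInf (R.Psi v)

/-- `b(e)`: the greatest element of `Ψ(e)`. -/
noncomputable def bE (v : V) : ℕ := sSup (R.Psi v)

/-- The edge `(par x, x)` is dominating: `b(e') + 2 ≤ a(e)` for its sibling edge `e'`. -/
def Dominating (x : V) : Prop :=
  x ≠ R.root ∧ ∃ y, y ≠ R.root ∧ y ≠ x ∧ R.par y = R.par x ∧ R.bE y + 2 ≤ R.aE x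

/-- The path from `v` down to `t` consists of dominating edges. -/
def DomPath (v t : V) : Prop :=
  R.below v t ∧ ∀ x, R.below v x → R.below x t → x ≠ v → R.Dominating x

/-- Condition (a) for the edge `e = (par v, v)`. -/
def CondA (v : V) : Prop :=
  (∃ a b, R.Psi v = Iv a b) ∧
  (R.leaf v → R.Psi v = {R.c v}) ∧
  (∀ w₁ w₂, w₁ ≠ w₂ → R.children v = {w₁, w₂} →
    R.Psi v = (otimes (R.Psi w₁) (R.Psi w₂) ∩ Set.Iic (R.c v)) ∪ {R.c v})

/-- Condition (b) for the edge `e = (u,v)`: if `e` has a dominating child-edge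
`e' = (v,w)`, then there is a terminal `t ∈ T_{e'}` with `g(u,t) ≥ a(e)` for every
decomposition `g` of every blocking flow of `I(e)`, and `P_{v,t}` a dominating path. -/
def CondB (v : V) : Prop :=
  ∀ w ∈ R.children v, R.Dominating w →
    ∃ t ∈ R.Te w, R.DomPath v t ∧
      ∀ f g, R.IsBlocking v f → R.IsDecomp v f g → R.aE v ≤ g s(R.par v, t)

/-- `γ(𝒳)` for the cut-system `𝒳 = {V_f(t) : t ∈ T_e ∪ {u}}`. -/
noncomputable def gammaX (v : V) (f : V → ℕ) : ℕ :=
  ∑ᶠ t ∈ R.S v, R.hval v (R.Vf v f t) R.c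

/-- `κ(𝒳)` for the cut-system `𝒳 = {V_f(t) : t ∈ T_e ∪ {u}}`: the number of
components of `G_e − ∪𝒳` of odd capacity. -/
noncomputable def kappaX (v : V) (f : V → ℕ) : ℕ :=
  {W : Set V | R.IsComp v (R.Ve v \ R.USall v f) W ∧ Odd (R.hval v W R.c)}.ncard

end RTI

namespace RTI

variable {V : Type*} {R : RTI V}

theorem below_refl (a : V) : R.below a a := Relation.ReflTransGen.refl

theorem below.trans {a b d : V} (h₁ : R.below a b) (h₂ : R.below b d) : R.below a d :=
  Relation.ReflTransGen.trans h₁ h₂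

theorem below_par {a : V} (h : a ≠ R.root) : R.below (R.par a) a :=
  Relation.ReflTransGen.single ⟨rfl, h⟩

theorem below.eq_or_below_par {a b : V} (h : R.below a b) :
    b = a ∨ R.below a (R.par b) ∧ b ≠ R.root := by
  rcases Relation.ReflTransGen.cases_tail h with h | ⟨d, hd, rfl, hb⟩
  · exact Or.inl h
  · exact Or.inr ⟨hd, hb⟩

theorem below.dep_le {a b : V} (h : R.below a b) : R.dep a ≤ R.dep b := by
  induction h with
  | refl => exact le_rfl
  | tail _ h ih =>
    obtain ⟨rfl, h⟩ := h
    have := R.dep_par _ h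
    omega

theorem below.antisymm {a b : V} (h₁ : R.below a b) (h₂ : R.below b a) : a = b := by
  rcases h₁.eq_or_below_par with h | ⟨h, hb⟩
  · exact h.symm
  · have := R.dep_par _ hb
    have := h.dep_le
    have := h₂.dep_le
    omega

/-- The ancestors of a vertex form a chain. -/
theorem below.total {a b w : V} (ha : R.below a w) (hb : R.below b w) :
    R.below a b ∨ R.below b a := by
  induction ha with
  | refl => exact Or.inr hb
  | tail h₁ h₂ ih =>
    obtain ⟨rfl, hr⟩ := h₂
    rcases hb.eq_or_below_par with rfl | ⟨h, -⟩
    · exact Or.inl (h₁.trans (below_par hr))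
    · exact ih h

theorem below.ne_root {v x : V} (hv : v ≠ R.root) (h : R.below v x) : x ≠ R.root := by
  rcases h.eq_or_below_par with rfl | ⟨-, h⟩
  · exact hv
  · exact h

theorem par_below_of_mem_Ve {v w : V} (hv : v ≠ R.root) (h : w ∈ R.Ve v) :
    R.below (R.par v) w := by
  rcases h with rfl | h
  · exact below_refl _
  · exact (below_par hv).trans h

theorem par_mem_Ve {v y : V} (h : R.below v y) : R.par y ∈ R.Ve v := by
  rcases h.eq_or_below_par with rfl | ⟨h, -⟩
  · exact Or.inl rfl
  · exact Or.inr h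

theorem mem_Ve_of_below {v x w : V} (hx : R.below (R.par v) x) (hxw : R.below x w)
    (hw : w ∈ R.Ve v) : x ∈ R.Ve v := by
  rcases hw with rfl | hw
  · exact Or.inl (hxw.antisymm hx)
  · rcases hxw.total hw with h | h
    · rcases h.eq_or_below_par with rfl | ⟨h, -⟩
      · exact Or.inr (below_refl _)
      · exact Or.inl (h.antisymm hx)
    · exact Or.inr h

theorem mem_Vf_of_onPathV {v s w₁ w₂ x : V} {f : V → ℕ} (hv : v ≠ R.root)
    (h₁ : w₁ ∈ R.Vf v f s) (h₂ : w₂ ∈ R.Vf v f s) (hx : R.below x w₁)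
    (hlca : ∀ z, R.below z w₁ → R.below z w₂ → R.below z x) : x ∈ R.Vf v f s := by
  obtain ⟨hw₁, z₁, hz₁, hz₁s, hz₁w, hup₁, hdown₁⟩ := h₁
  obtain ⟨hw₂, z₂, hz₂, hz₂s, hz₂w, hup₂, hdown₂⟩ := h₂
  have hxV : x ∈ R.Ve v := mem_Ve_of_below
    (hlca _ (par_below_of_mem_Ve hv hw₁) (par_below_of_mem_Ve hv hw₂)) hx hw₁
  refine ⟨hxV, ?_⟩
  rcases hz₁w.total hx with h | h
  · exact ⟨z₁, hz₁, hz₁s, h, hup₁, fun y hy hyx => hdown₁ y hy (hyx.trans hx)⟩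
  have hz₂x : R.below z₂ x ∨ x = z₁ := by
    rcases hz₁s.total hz₂s with h' | h'
    · exact Or.inr (h.antisymm (hlca _ hz₁w (h'.trans hz₂w)))
    · exact Or.inl (hlca _ (h'.trans hz₁w) hz₂w)
  rcases hz₂x with hz₂x | rfl
  · refine ⟨x, hxV, h.trans hz₁s, below_refl x, fun y hy hys hne => ?_,
      fun y hy hyx hne => absurd (hyx.antisymm hy) hne⟩
    refine hup₂ y (hz₂x.trans hy) hys ?_
    rintro rfl
    exact hne (hz₂x.antisymm hy)
  · exact ⟨x, hz₁, hz₁s, below_refl x, hup₁,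
      fun y hy hyx hne => absurd (hyx.antisymm hy) hne⟩

theorem connSet_Vf {v s : V} {f : V → ℕ} (hv : v ≠ R.root) : R.ConnSet (R.Vf v f s) := by
  rintro w₁ h₁ w₂ h₂ x ⟨hx | hx, hlca⟩
  · exact mem_Vf_of_onPathV hv h₁ h₂ hx hlca
  · exact mem_Vf_of_onPathV hv h₂ h₁ hx fun z hz₁ hz₂ => hlca z hz₂ hz₁

theorem par_mem_Vf {v s y : V} {f : V → ℕ} (hv : v ≠ R.root) (hy : y ∈ R.Vf v f s)
    (hvy : R.below v y) (hf : f y + 1 ≤ R.c y) : R.par y ∈ R.Vf v f s := by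
  obtain ⟨-, z, hz, hzs, hzy, hup, hdown⟩ := hy
  have hr : y ≠ R.root := hvy.ne_root hv
  refine ⟨par_mem_Ve hvy, ?_⟩
  rcases hzy.eq_or_below_par with rfl | ⟨h, -⟩
  · refine ⟨R.par y, par_mem_Ve hvy, (below_par hr).trans hzs, below_refl _,
      fun x hx hxs hne => ?_, fun x hx hxy hne => absurd (hxy.antisymm hx) hne⟩
    by_cases hxy : x = y
    · rwa [hxy]
    rcases hxs.total hzs with h | h
    · rcases h.eq_or_below_par with h | ⟨h, -⟩
      · exact absurd h.symm hxy
      · exact absurd (h.antisymm hx) hne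
    · exact hup x h hxs hxy
  · exact ⟨z, hz, hzs, h, hup, fun x hx hxy => hdown x hx (hxy.trans (below_par hr))⟩

theorem mem_Vf_of_par_mem {v s x : V} {f : V → ℕ} (hv : v ≠ R.root) (hvx : R.below v x)
    (hx : R.par x ∈ R.Vf v f s) (hf : f x + 2 ≤ R.c x) : x ∈ R.Vf v f s := by
  obtain ⟨-, z, hz, hzs, hzx, hup, hdown⟩ := hx
  refine ⟨Or.inr hvx, z, hz, hzs, hzx.trans (below_par (hvx.ne_root hv)), hup,
    fun y hy hyx hne => ?_⟩
  rcases hyx.eq_or_below_par with rfl | ⟨h, -⟩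
  · exact hf
  · exact hdown y hy h hne

end RTI

/-- for a feasible flow `f` in a rooted tree instance `I(e)` and any vertex
`s ∈ V_e`, the set `V_f(s)` induces a connected subgraph of `G_e`; the parent-edge of
`V_f(s)` (if it exists) is saturated; and every child-edge `e'` of `V_f(s)` satisfies
`f(e') ∈ {c(e')−1, c(e')}`. -/
theorem RTI.Vf_connected_parent_saturated_child_almost {V : Type*} [Fintype V]
    [DecidableEq V] (R : RTI V) (v : V) (hv : v ≠ R.root)
    (f : V → ℕ) (hf : R.IsFlow v f) (hfc : R.Feasible v f)
    (s : V) (hs : s ∈ R.Ve v) :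
    R.ConnSet (R.Vf v f s) ∧
    (∀ y, y ∈ R.Vf v f s → R.par y ∉ R.Vf v f s → R.below v y → f y = R.c y) ∧
    (∀ x, R.below v x → R.par x ∈ R.Vf v f s → x ∉ R.Vf v f s →
      f x = R.c x ∨ f x + 1 = R.c x) := by
  refine ⟨connSet_Vf hv, fun y hy hpy hvy => ?_, fun x hvx hpx hx => ?_⟩
  · by_contra hne
    have := hfc y hvy
    exact hpy (par_mem_Vf hv hy hvy (by omega))
  · by_contra hne
    have := hfc x hvx
    exact hx (mem_Vf_of_par_mem hv hvx hpx (by omega))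
end
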